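/- Let μ be a Borel probability measure on ℝ, not a Dirac measure, with m_8(μ) < ∞, m_1(μ) = 0, m_2(μ) = 1 and m_3(μ) ≠ 0. Then there exist a constant c(μ) > 0 and n₁ = n₁(μ) ∈ ℕ such that for all n ≥ n₁: | ∫_ℝ |p_n(x) − p_w(x)| dx − 2|m_3(μ)|/(π √n) | ≤ c(μ) (|a_n|^{3/2} + n^{−1}). -/

import Mathlib

open MeasureTheory Complex Filter Set
open scoped Topology

noncomputable section

namespace FreeCLT

def mom (μ : Measure ℝ) (k : ℕ) : ℝ := ∫ u, u ^ k ∂μ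

def cauchy (μ : Measure ℝ) (z : ℂ) : ℂ := ∫ u, (z - (u : ℂ))⁻¹ ∂μ

def recip (μ : Measure ℝ) (z : ℂ) : ℂ := (cauchy μ z)⁻¹

def MemF (F : ℂ → ℂ) : Prop :=
  ∃ ν : Measure ℝ, IsProbabilityMeasure ν ∧ ∀ z : ℂ, 0 < z.im → F z = recip ν z

def Subord (μ : Measure ℝ) (n : ℕ) (Z : ℂ → ℂ) : Prop :=
  MemF Z ∧ ∀ z : ℂ, 0 < z.im →
    z = (n : ℂ) * Z z - ((n : ℂ) - 1) * recip μ (Z z)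

def IsBoxPow (μ : Measure ℝ) (n : ℕ) (Z : ℂ → ℂ) (ν : Measure ℝ) : Prop :=
  Subord μ n Z ∧ IsProbabilityMeasure ν ∧
    ∀ z : ℂ, 0 < z.im → recip ν z = recip μ (Z z)

def rescale (n : ℕ) (ν : Measure ℝ) : Measure ℝ :=
  ν.map (fun x => x / Real.sqrt n)

def HasDensity (ν : Measure ℝ) (p : ℝ → ℝ) : Prop :=
  Continuous p ∧ (∀ x, 0 ≤ p x) ∧
    ν = MeasureTheory.volume.withDensity (fun x => ENNReal.ofReal (p x))

def aQ (μ : Measure ℝ) (n : ℕ) : ℝ := mom μ 3 / Real.sqrt n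
def bQ (μ : Measure ℝ) (n : ℕ) : ℝ := (mom μ 4 - (mom μ 3) ^ 2 - 1) / n
def dQ (μ : Measure ℝ) (n : ℕ) : ℝ := (mom μ 4 - (mom μ 3) ^ 2) / n
def eQ (μ : Measure ℝ) (n : ℕ) : ℝ := (1 - bQ μ n) / Real.sqrt (1 - dQ μ n)

def pw (x : ℝ) : ℝ := (1 / (2 * Real.pi)) * Real.sqrt (max (4 - x ^ 2) 0)

def truncSet (n : ℕ) : Set ℝ := {u : ℝ | |u| ≤ Real.sqrt ((n : ℝ) - 1) / Real.pi}

def Tfun (W : ℕ → ℂ → ℂ) (n : ℕ) (z : ℂ) : ℂ :=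
  W n ((Real.sqrt (n : ℝ) : ℂ) * z) / (Real.sqrt (n : ℝ) : ℂ)

lemma int_pow {μ : Measure ℝ} [IsProbabilityMeasure μ] (h8 : Integrable (fun u : ℝ => u ^ 8) μ)
    {k : ℕ} (hk : k ≤ 8) : Integrable (fun u : ℝ => u ^ k) μ := by
  refine Integrable.mono' ((integrable_const (1:ℝ)).add h8) (by fun_prop) (ae_of_all _ fun u => ?_)
  simp only [Pi.add_apply, norm_pow, Real.norm_eq_abs]
  have h : u ^ 8 = |u| ^ 8 := by rw [← abs_pow]; exact (abs_of_nonneg (by positivity)).symm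
  rw [h]
  rcases le_total |u| 1 with h1 | h1
  · have := pow_le_one₀ (n := k) (abs_nonneg u) h1
    have : 0 ≤ |u| ^ 8 := by positivity
    linarith
  · have := pow_le_pow_right₀ h1 hk
    linarith

lemma int_cpow {μ : Measure ℝ} [IsProbabilityMeasure μ] (h8 : Integrable (fun u : ℝ => u ^ 8) μ)
    {k : ℕ} (hk : k ≤ 8) : Integrable (fun u : ℝ => (u : ℂ) ^ k) μ := by
  have := (int_pow h8 hk).ofReal (𝕜 := ℂ)
  simpa using this

lemma integral_cpow (μ : Measure ℝ) (k : ℕ) :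
    ∫ u : ℝ, (u : ℂ) ^ k ∂μ = (mom μ k : ℂ) := by
  have := integral_ofReal (μ := μ) (𝕜 := ℂ) (f := fun u : ℝ => u ^ k)
  simpa [mom] using this

lemma ne_of_im {w : ℂ} (hw : 0 < w.im) (u : ℝ) : w - (u : ℂ) ≠ 0 := by
  intro h
  have := congrArg Complex.im h
  simp at this
  linarith

lemma norm_g_le {w : ℂ} (hw : 0 < w.im) (u : ℝ) : ‖(w - (u : ℂ))⁻¹‖ ≤ w.im⁻¹ := by
  rw [norm_inv]
  apply inv_anti₀ hw
  have := Complex.abs_im_le_norm (w - (u : ℂ))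
  simp at this
  exact (le_abs_self _).trans this

lemma cont_g {w : ℂ} (hw : 0 < w.im) : Continuous fun u : ℝ => (w - (u : ℂ))⁻¹ :=
  Continuous.inv₀ (by fun_prop) (ne_of_im hw)

lemma int_g {μ : Measure ℝ} [IsProbabilityMeasure μ] {w : ℂ} (hw : 0 < w.im) :
    Integrable (fun u : ℝ => (w - (u : ℂ))⁻¹) μ :=
  Integrable.mono' (integrable_const w.im⁻¹) (cont_g hw).aestronglyMeasurable
    (ae_of_all _ (norm_g_le hw))

lemma int_g2 {μ : Measure ℝ} [IsProbabilityMeasure μ] {w : ℂ} (hw : 0 < w.im) :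
    Integrable (fun u : ℝ => ‖(w - (u : ℂ))⁻¹‖ ^ 2) μ :=
  Integrable.mono' (integrable_const (w.im⁻¹ ^ 2))
    ((cont_g hw).norm.pow 2).aestronglyMeasurable
    (ae_of_all _ fun u => by
      rw [norm_pow, norm_norm]
      exact pow_le_pow_left₀ (norm_nonneg _) (norm_g_le hw u) 2)

lemma g_im (w : ℂ) (u : ℝ) :
    ((w - (u : ℂ))⁻¹).im = - w.im * ‖(w - (u : ℂ))⁻¹‖ ^ 2 := by
  rw [Complex.inv_im, norm_inv, inv_pow, ← Complex.normSq_eq_norm_sq]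
  simp [div_eq_mul_inv]

lemma cauchy_im {μ : Measure ℝ} [IsProbabilityMeasure μ] {w : ℂ} (hw : 0 < w.im) :
    (cauchy μ w).im = - w.im * ∫ u : ℝ, ‖(w - (u : ℂ))⁻¹‖ ^ 2 ∂μ := by
  have : (cauchy μ w).im = ∫ u : ℝ, ((w - (u : ℂ))⁻¹).im ∂μ :=
    (Complex.imCLM.integral_comp_comm (int_g hw)).symm
  rw [this, ← integral_const_mul]
  exact integral_congr_ae (ae_of_all _ fun u => g_im w u)

lemma cauchy_re {μ : Measure ℝ} [IsProbabilityMeasure μ] {w : ℂ} (hw : 0 < w.im) :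
    (cauchy μ w).re = ∫ u : ℝ, ((w - (u : ℂ))⁻¹).re ∂μ :=
    (Complex.reCLM.integral_comp_comm (int_g hw)).symm
lemma cauchy_im' {μ : Measure ℝ} [IsProbabilityMeasure μ] {w : ℂ} (hw : 0 < w.im) :
    (cauchy μ w).im = ∫ u : ℝ, ((w - (u : ℂ))⁻¹).im ∂μ :=
    (Complex.imCLM.integral_comp_comm (int_g hw)).symm

lemma S_pos {μ : Measure ℝ} [IsProbabilityMeasure μ] {w : ℂ} (hw : 0 < w.im) :
    0 < ∫ u : ℝ, ‖(w - (u : ℂ))⁻¹‖ ^ 2 ∂μ := by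
  rw [integral_pos_iff_support_of_nonneg (fun u => by positivity) (int_g2 hw)]
  have : Function.support (fun u : ℝ => ‖(w - (u : ℂ))⁻¹‖ ^ 2) = univ := by
    ext u
    simp [ne_of_im hw u]
  rw [this]; simp

lemma cauchy_im_neg {μ : Measure ℝ} [IsProbabilityMeasure μ] {w : ℂ} (hw : 0 < w.im) :
    (cauchy μ w).im < 0 := by
  rw [cauchy_im hw]
  have := mul_pos hw (S_pos (μ := μ) hw)
  linarith

lemma cauchy_ne {μ : Measure ℝ} [IsProbabilityMeasure μ] {w : ℂ} (hw : 0 < w.im) :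
    cauchy μ w ≠ 0 := fun h => by
  have := cauchy_im_neg (μ := μ) hw
  simp [h] at this

lemma recip_im_pos {μ : Measure ℝ} [IsProbabilityMeasure μ] {w : ℂ} (hw : 0 < w.im) :
    0 < (recip μ w).im := by
  rw [recip, Complex.inv_im]
  have := cauchy_im_neg (μ := μ) hw
  have h2 := Complex.normSq_pos.mpr (cauchy_ne (μ := μ) hw)
  apply div_pos _ h2
  linarith

/-- key variance inequality -/
lemma varS {μ : Measure ℝ} [IsProbabilityMeasure μ] {w : ℂ} (hw : 0 < w.im) {N : ℝ}
    (hz : 0 < ((N : ℂ) * w - ((N : ℂ) - 1) * recip μ w).im) :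
    (N - 1) * ∫ u : ℝ, ‖(w - (u : ℂ))⁻¹‖ ^ 2 ∂μ ≤ N * ‖cauchy μ w‖ ^ 2 := by
  have hG := Complex.normSq_pos.mpr (cauchy_ne (μ := μ) hw)
  have h1 : ((N : ℂ) * w - ((N : ℂ) - 1) * recip μ w).im
      = N * w.im - (N - 1) * (recip μ w).im := by
    simp
  rw [h1, recip, Complex.inv_im, cauchy_im hw] at hz
  rw [← Complex.normSq_eq_norm_sq]
  set S := ∫ u : ℝ, ‖(w - (u : ℂ))⁻¹‖ ^ 2 ∂μ
  set Q := Complex.normSq (cauchy μ w)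
  have h2 : N * w.im - (N - 1) * (-(-w.im * S) / Q) = w.im / Q * (N * Q - (N - 1) * S) := by
    field_simp
  rw [h2] at hz
  have h3 : 0 < w.im / Q := by positivity
  have := (pos_iff_pos_of_mul_pos hz).mp h3
  linarith

lemma var_eq {μ : Measure ℝ} [IsProbabilityMeasure μ] {w : ℂ} (hw : 0 < w.im) :
    Integrable (fun u : ℝ => ‖(w - (u : ℂ))⁻¹ - cauchy μ w‖ ^ 2) μ ∧
    ∫ u : ℝ, ‖(w - (u : ℂ))⁻¹ - cauchy μ w‖ ^ 2 ∂μ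
      = (∫ u : ℝ, ‖(w - (u : ℂ))⁻¹‖ ^ 2 ∂μ) - ‖cauchy μ w‖ ^ 2 := by
  have hre : Integrable (fun u : ℝ => ((w - (u : ℂ))⁻¹).re) μ := (int_g hw).re
  have him : Integrable (fun u : ℝ => ((w - (u : ℂ))⁻¹).im) μ := (int_g hw).im
  have hr := cauchy_re (μ := μ) hw
  have hi := cauchy_im' (μ := μ) hw
  set G := cauchy μ w
  have e : (fun u : ℝ => ‖(w - (u : ℂ))⁻¹ - G‖ ^ 2) = fun u : ℝ =>
      (‖(w - (u : ℂ))⁻¹‖ ^ 2 - (2 * G.re * ((w - (u : ℂ))⁻¹).re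
        + 2 * G.im * ((w - (u : ℂ))⁻¹).im)) + ‖G‖ ^ 2 := by
    ext u
    simp only [← Complex.normSq_eq_norm_sq, Complex.normSq_apply, Complex.sub_re, Complex.sub_im]
    ring
  have i1 := (hre.const_mul (2 * G.re))
  have i2 := (him.const_mul (2 * G.im))
  have i3 : Integrable (fun u : ℝ => ‖(w - (u : ℂ))⁻¹‖ ^ 2 - (2 * G.re * ((w - (u : ℂ))⁻¹).re
        + 2 * G.im * ((w - (u : ℂ))⁻¹).im)) μ := (int_g2 hw).sub (i1.add i2)
  rw [e]
  constructor
  · exact ((int_g2 hw).sub (i1.add i2)).add (integrable_const _)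
  · rw [integral_add i3 (integrable_const _),
      integral_sub (int_g2 hw) (i1.fun_add i2), integral_add i1 i2, integral_const_mul,
      integral_const_mul, ← hr, ← hi]
    simp only [← Complex.normSq_eq_norm_sq, Complex.normSq_apply]
    simp
    ring

/-- a priori lower bound -/
lemma lower {μ : Measure ℝ} [IsProbabilityMeasure μ] (h8 : Integrable (fun u : ℝ => u ^ 8) μ)
    (h1 : mom μ 1 = 0) (h2 : mom μ 2 = 1)
    {w : ℂ} (hw : 0 < w.im) {N : ℝ} (hN : 1 < N)
    (hz : 0 < ((N : ℂ) * w - ((N : ℂ) - 1) * recip μ w).im) :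
    N - 1 ≤ 2 * ‖w‖ ^ 2 + 2 * mom μ 4 := by
  have hV := varS (μ := μ) hw hz
  obtain ⟨hvi, hv⟩ := var_eq (μ := μ) hw
  have hGne := cauchy_ne (μ := μ) hw
  set G := cauchy μ w with hG
  have hGp : 0 < ‖G‖ := norm_pos_iff.mpr hGne
  have hN' : 0 < N - 1 := by linarith
  have c1 := int_cpow h8 (k := 1) (by norm_num)
  have c2 := int_cpow h8 (k := 2) (by norm_num)
  have r2 := int_pow h8 (k := 2) (by norm_num)
  have r4 := int_pow h8 (k := 4) (by norm_num)
  have id : ∫ u : ℝ, (u : ℂ) * (w - u) * ((w - (u : ℂ))⁻¹ - G) ∂μ = G := by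
    have e : (fun u : ℝ => (u : ℂ) * (w - u) * ((w - (u : ℂ))⁻¹ - G))
        = fun u : ℝ => (1 - w * G) * (u : ℂ) ^ 1 + G * (u : ℂ) ^ 2 := by
      ext u
      have := ne_of_im hw u
      field_simp
      ring
    rw [e, integral_add (c1.const_mul _) (c2.const_mul _), integral_const_mul, integral_const_mul,
      integral_cpow, integral_cpow, h1, h2]
    simp
  have bd : ‖G‖ ≤ ∫ u : ℝ, ((‖G‖ / (N - 1)) * (‖w‖ ^ 2 * u ^ 2 + u ^ 4)
      + (N - 1) / (2 * ‖G‖) * ‖(w - (u : ℂ))⁻¹ - G‖ ^ 2) ∂μ := by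
    conv_lhs => rw [← id]
    apply norm_integral_le_of_norm_le
    · exact (((r2.const_mul _).add r4).const_mul _).add (hvi.const_mul _)
    · refine ae_of_all _ fun u => ?_
      rw [norm_mul, norm_mul, Complex.norm_real]
      set y := ‖(w - (u : ℂ))⁻¹ - G‖
      have hx : ‖w - (u : ℂ)‖ ≤ ‖w‖ + ‖u‖ := by
        simpa using norm_sub_le w (u : ℂ)
      set b := ‖w - (u : ℂ)‖
      have hb : 0 ≤ b := norm_nonneg _
      have hu : u ^ 2 = ‖u‖ ^ 2 := by simp
      have hu4 : u ^ 4 = ‖u‖ ^ 4 := by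
        calc u ^ 4 = (u ^ 2) ^ 2 := by ring
          _ = ‖u‖ ^ 4 := by rw [hu]; ring
      rw [hu, hu4]
      set v := ‖u‖
      have hv0 : 0 ≤ v := norm_nonneg _
      have hb2 : b ^ 2 ≤ 2 * (‖w‖ ^ 2 + v ^ 2) := by
        nlinarith [norm_nonneg w, sq_nonneg (‖w‖ - v), sq_nonneg (‖w‖ + v - b)]
      have key : v * b * y ≤ ‖G‖ / (N - 1) * ((v * b) ^ 2 / 2) + (N - 1) / (2 * ‖G‖) * y ^ 2 := by
        have hq : 0 ≤ (‖G‖ * (v * b) - (N - 1) * y) ^ 2 / (2 * ‖G‖ * (N - 1)) := by positivity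
        have : (‖G‖ * (v * b) - (N - 1) * y) ^ 2 / (2 * ‖G‖ * (N - 1))
          = ‖G‖ / (N - 1) * ((v * b) ^ 2 / 2) + (N - 1) / (2 * ‖G‖) * y ^ 2 - v * b * y := by
          field_simp
          ring
        linarith
      refine key.trans ?_
      gcongr
      nlinarith [mul_le_mul_of_nonneg_left hb2 (sq_nonneg v)]
  rw [integral_add (((r2.const_mul _).fun_add r4).const_mul _) (hvi.const_mul _), integral_const_mul,
    integral_const_mul, integral_add (r2.const_mul _) r4, integral_const_mul, hv] at bd
  change ‖G‖ ≤ ‖G‖ / (N - 1) * (‖w‖ ^ 2 * mom μ 2 + mom μ 4) + _ at bd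
  rw [h2] at bd
  set S := ∫ u : ℝ, ‖(w - (u : ℂ))⁻¹‖ ^ 2 ∂μ
  have hS : (N - 1) / (2 * ‖G‖) * (S - ‖G‖ ^ 2) ≤ ‖G‖ / 2 := by
    rw [div_mul_eq_mul_div, div_le_div_iff₀ (by positivity) (by norm_num)]
    nlinarith
  have h5 : ‖G‖ / 2 ≤ ‖G‖ / (N - 1) * (‖w‖ ^ 2 * 1 + mom μ 4) := by linarith
  rw [div_mul_eq_mul_div, div_le_div_iff₀ (by norm_num) hN'] at h5
  nlinarith

lemma expand {μ : Measure ℝ} [IsProbabilityMeasure μ] (h8 : Integrable (fun u : ℝ => u ^ 8) μ)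
    (h1 : mom μ 1 = 0) (h2 : mom μ 2 = 1)
    {w : ℂ} (hw : 0 < w.im) {N : ℝ} (hN : 2 ≤ N)
    (hz : 0 < ((N : ℂ) * w - ((N : ℂ) - 1) * recip μ w).im) :
    ∃ ρ : ℂ, ‖ρ‖ ≤ mom μ 8 + 1 ∧
      cauchy μ w * (1 - ρ * w⁻¹ ^ 4) = w⁻¹ + w⁻¹ ^ 3 + (mom μ 3 : ℂ) * w⁻¹ ^ 4 := by
  have hV := varS (μ := μ) hw hz
  have hGne := cauchy_ne (μ := μ) hw
  have hw0 : w ≠ 0 := by intro h; simp [h] at hw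
  set G := cauchy μ w with hG
  have hGp : 0 < ‖G‖ := norm_pos_iff.mpr hGne
  have hS : ∫ u : ℝ, ‖(w - (u : ℂ))⁻¹‖ ^ 2 ∂μ ≤ 2 * ‖G‖ ^ 2 := by
    have hSp := S_pos (μ := μ) hw
    nlinarith [sq_nonneg ‖G‖]
  have hcont : Continuous fun u : ℝ => (u : ℂ) ^ 4 * (w - (u : ℂ))⁻¹ :=
    Continuous.mul (by fun_prop) (cont_g hw)
  have bint : Integrable (fun u : ℝ => ‖G‖ / 2 * u ^ 8 + 1 / (2 * ‖G‖) * ‖(w - (u : ℂ))⁻¹‖ ^ 2) μ :=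
    (h8.const_mul _).add ((int_g2 hw).const_mul _)
  have bnd : ∀ u : ℝ, ‖(u : ℂ) ^ 4 * (w - (u : ℂ))⁻¹‖ ≤
      ‖G‖ / 2 * u ^ 8 + 1 / (2 * ‖G‖) * ‖(w - (u : ℂ))⁻¹‖ ^ 2 := by
    intro u
    rw [norm_mul, norm_pow, Complex.norm_real]
    have hu8 : u ^ 8 = (‖u‖ ^ 4) ^ 2 := by
      have hu : u ^ 2 = ‖u‖ ^ 2 := by simp
      calc u ^ 8 = (u ^ 2) ^ 4 := by ring
        _ = _ := by rw [hu]; ring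
    rw [hu8]
    set v := ‖u‖ ^ 4
    set y := ‖(w - (u : ℂ))⁻¹‖
    have hq : 0 ≤ (‖G‖ * v - y) ^ 2 / (2 * ‖G‖) := by positivity
    have : (‖G‖ * v - y) ^ 2 / (2 * ‖G‖) = ‖G‖ / 2 * v ^ 2 + 1 / (2 * ‖G‖) * y ^ 2 - v * y := by
      field_simp
      ring
    linarith
  have i4 : Integrable (fun u : ℝ => (u : ℂ) ^ 4 * (w - (u : ℂ))⁻¹) μ :=
    Integrable.mono' bint hcont.aestronglyMeasurable (ae_of_all _ bnd)
  have hR : ‖∫ u : ℝ, (u : ℂ) ^ 4 * (w - (u : ℂ))⁻¹ ∂μ‖ ≤ ‖G‖ * (mom μ 8 + 1) := by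
    refine (norm_integral_le_of_norm_le bint (ae_of_all _ bnd)).trans ?_
    rw [integral_add (h8.const_mul _) ((int_g2 hw).const_mul _), integral_const_mul,
      integral_const_mul]
    change ‖G‖ / 2 * mom μ 8 + _ ≤ _
    have : 1 / (2 * ‖G‖) * ∫ u : ℝ, ‖(w - (u : ℂ))⁻¹‖ ^ 2 ∂μ ≤ 1 / (2 * ‖G‖) * (2 * ‖G‖ ^ 2) := by
      gcongr
    have e : 1 / (2 * ‖G‖) * (2 * ‖G‖ ^ 2) = ‖G‖ := by field_simp
    have h0 : 0 ≤ mom μ 8 := integral_nonneg fun u => by positivity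
    nlinarith
  have id : G = w⁻¹ + w⁻¹ ^ 3 + (mom μ 3 : ℂ) * w⁻¹ ^ 4
      + w⁻¹ ^ 4 * ∫ u : ℝ, (u : ℂ) ^ 4 * (w - (u : ℂ))⁻¹ ∂μ := by
    have c0 := (int_cpow h8 (k := 0) (by norm_num)).const_mul w⁻¹
    have c1 := (int_cpow h8 (k := 1) (by norm_num)).const_mul (w⁻¹ ^ 2)
    have c2 := (int_cpow h8 (k := 2) (by norm_num)).const_mul (w⁻¹ ^ 3)
    have c3 := (int_cpow h8 (k := 3) (by norm_num)).const_mul (w⁻¹ ^ 4)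
    have c4 := i4.const_mul (w⁻¹ ^ 4)
    have m0 : mom μ 0 = 1 := by simp [mom]
    have e : (fun u : ℝ => (w - (u : ℂ))⁻¹) = fun u : ℝ =>
        w⁻¹ * (u : ℂ) ^ 0 + w⁻¹ ^ 2 * (u : ℂ) ^ 1 + w⁻¹ ^ 3 * (u : ℂ) ^ 2 + w⁻¹ ^ 4 * (u : ℂ) ^ 3
          + w⁻¹ ^ 4 * ((u : ℂ) ^ 4 * (w - (u : ℂ))⁻¹) := by
      ext u
      have := ne_of_im hw u
      field_simp
      ring
    have hG' : G = ∫ u : ℝ, (w - (u : ℂ))⁻¹ ∂μ := rfl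
    rw [hG', e]
    rw [integral_add (((c0.fun_add c1).fun_add c2).fun_add c3) c4,
      integral_add ((c0.fun_add c1).fun_add c2) c3, integral_add (c0.fun_add c1) c2, integral_add c0 c1]
    simp only [integral_const_mul, integral_cpow, m0, h1, h2]
    push_cast
    ring
  refine ⟨(∫ u : ℝ, (u : ℂ) ^ 4 * (w - (u : ℂ))⁻¹ ∂μ) / G, ?_, ?_⟩
  · rw [norm_div, div_le_iff₀ hGp]
    linarith
  · set I := ∫ u : ℝ, (u : ℂ) ^ 4 * (w - (u : ℂ))⁻¹ ∂μ
    have : G * (1 - I / G * w⁻¹ ^ 4) = G - w⁻¹ ^ 4 * I := by field_simp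
    rw [this]
    conv_lhs => rw [id]
    ring

lemma alg1 {M A N : ℝ} (hN : 1 ≤ N) (hNM : 32 * M ≤ N) (hM : 0 ≤ M) {a : ℝ} (ha : |a| ≤ A)
    {t g z ρ : ℂ} (ht0 : t ≠ 0) (ht : ‖t‖ ≤ 2) (hρ : ‖ρ‖ ≤ M) (hz : ‖z‖ ≤ 3)
    (h1 : g * (1 - ρ * t ^ 4 / N ^ 2) = t + t ^ 3 / N + a * t ^ 4 / N)
    (h2 : g * z * t = N * g - (N - 1) * t) :
    ‖g - t‖ ≤ (8 + 16 * A + 16 * M * (20 + 32 * A)) / N ∧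
    ‖1 + t ^ 2 + a * t ^ 3 - z * t‖ ≤
      (3 * (8 + 16 * A + 16 * M * (20 + 32 * A)) + 8 * M * (20 + 32 * A)) / N := by
  have hA : 0 ≤ A := (abs_nonneg a).trans ha
  have hN0 : 0 < N := by linarith
  have hNc : (N : ℂ) ≠ 0 := by exact_mod_cast hN0.ne'
  have hNn : ‖(N : ℂ)‖ = N := by simp [abs_of_pos hN0]
  have han : ‖(a : ℂ)‖ ≤ A := by simpa using ha
  have t3 : ‖t ^ 3‖ ≤ 8 := by
    rw [norm_pow]; calc ‖t‖ ^ 3 ≤ 2 ^ 3 := by gcongr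
      _ = 8 := by norm_num
  have t4 : ‖t ^ 4‖ ≤ 16 := by
    rw [norm_pow]; calc ‖t‖ ^ 4 ≤ 2 ^ 4 := by gcongr
      _ = 16 := by norm_num
  have hat4 : ‖a * t ^ 4‖ ≤ A * 16 := by rw [norm_mul]; gcongr
  have hρt4 : ‖ρ * t ^ 4‖ ≤ M * 16 := by rw [norm_mul]; gcongr
  have hρt3 : ‖ρ * t ^ 3‖ ≤ M * 8 := by rw [norm_mul]; gcongr
  have hB : ‖ρ * t ^ 4 / N ^ 2‖ ≤ 1 / 2 := by
    rw [norm_div, norm_pow, hNn, div_le_div_iff₀ (by positivity) (by norm_num)]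
    nlinarith
  have hB2 : 1 / 2 ≤ ‖1 - ρ * t ^ 4 / N ^ 2‖ := by
    have := norm_sub_norm_le (1 : ℂ) (ρ * t ^ 4 / N ^ 2)
    rw [norm_one] at this
    linarith
  have hrhs : ‖t + t ^ 3 / N + a * t ^ 4 / N‖ ≤ 10 + 16 * A := by
    refine (norm_add₃_le).trans ?_
    rw [norm_div, norm_div, hNn]
    have e1 : ‖t ^ 3‖ / N ≤ 8 := (div_le_self (norm_nonneg _) hN).trans t3
    have e2 : ‖a * t ^ 4‖ / N ≤ A * 16 := (div_le_self (norm_nonneg _) hN).trans hat4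
    linarith
  have hg : ‖g‖ ≤ 20 + 32 * A := by
    have := congrArg norm h1
    rw [norm_mul] at this
    nlinarith [norm_nonneg g]
  have e1 : g - t = (t ^ 3 + a * t ^ 4 + g * (ρ * t ^ 4) / N) / N := by
    have : g = t + t ^ 3 / N + a * t ^ 4 / N + g * (ρ * t ^ 4 / N ^ 2) := by
      rw [← h1]; ring
    calc g - t = (t + t ^ 3 / N + a * t ^ 4 / N + g * (ρ * t ^ 4 / N ^ 2)) - t := by rw [← this]
      _ = _ := by field_simp; ring
  have c1 : ‖g - t‖ ≤ (8 + 16 * A + 16 * M * (20 + 32 * A)) / N := by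
    rw [e1, norm_div, hNn]
    gcongr
    refine (norm_add₃_le).trans ?_
    have : ‖g * (ρ * t ^ 4) / N‖ ≤ (20 + 32 * A) * (M * 16) := by
      rw [norm_div, hNn]
      refine (div_le_self (norm_nonneg _) hN).trans ?_
      rw [norm_mul]; gcongr
    linarith
  refine ⟨c1, ?_⟩
  have e2 : g * z = 1 + t ^ 2 + a * t ^ 3 + g * (ρ * t ^ 3) / N := by
    have : g * z * t = (1 + t ^ 2 + a * t ^ 3 + g * (ρ * t ^ 3) / N) * t := by
      rw [h2]
      have : N * g - (N - 1) * t = N * (g - t) + t := by ring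
      rw [this, e1]
      field_simp
      ring
    exact mul_right_cancel₀ ht0 this
  have e3 : 1 + t ^ 2 + a * t ^ 3 - z * t = z * (g - t) - g * (ρ * t ^ 3) / N := by
    linear_combination -e2
  rw [e3]
  refine (norm_sub_le _ _).trans ?_
  rw [norm_mul, norm_div, hNn, norm_mul, add_div]
  have f1 : ‖z‖ * ‖g - t‖ ≤ 3 * ((8 + 16 * A + 16 * M * (20 + 32 * A)) / N) := by gcongr
  have f2 : ‖g‖ * ‖ρ * t ^ 3‖ / N ≤ (20 + 32 * A) * (M * 8) / N := by gcongr
  calc _ ≤ _ := add_le_add f1 f2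
    _ = _ := by ring

set_option maxHeartbeats 1000000 in
lemma alg2 {K A N : ℝ} (hN : 1 ≤ N) (hK : 0 ≤ K) {a : ℝ} (ha : |a| ≤ A / Real.sqrt N)
    {t g z : ℂ} {θ : ℝ} (hθ : 0 < Real.sin θ) (ht : ‖t‖ ≤ 2) (htim : t.im < 0)
    (hg : ‖g - t‖ ≤ K / N) (hE : ‖1 + t ^ 2 + a * t ^ 3 - z * t‖ ≤ K / N)
    (hz : ‖z - (2 * Real.cos θ : ℝ)‖ ≤ 1 / N) :
    |2 * Real.sin θ * (g.im + Real.sin θ) + a * Real.cos (3 * θ)|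
      ≤ (3 * K + 2 + 7 * A * (K + 2 + 8 * A) + (K + 2 + 8 * A) ^ 2) / (N * Real.sin θ ^ 2) := by
  have hN0 : 0 < N := by linarith
  have hq : 0 < Real.sqrt N := Real.sqrt_pos.mpr hN0
  have hq1 : 1 ≤ Real.sqrt N := Real.one_le_sqrt.mpr hN
  have hqq : Real.sqrt N ^ 2 = N := Real.sq_sqrt hN0.le
  have hs1 : Real.sin θ ≤ 1 := Real.sin_le_one θ
  have hcs := Real.sin_sq_add_cos_sq θ
  have h3 : Real.cos (3 * θ) = Real.cos θ ^ 3 - 3 * Real.cos θ * Real.sin θ ^ 2 := by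
    rw [Real.cos_three_mul]
    linear_combination (3 * Real.cos θ) * hcs
  rw [h3]
  set s := Real.sin θ
  set c := Real.cos θ
  set q := Real.sqrt N
  have hA : 0 ≤ A := by
    have := (abs_nonneg a).trans ha
    by_contra h
    push Not at h
    have := div_neg_of_neg_of_pos h hq
    linarith
  set f : ℂ := ⟨c, -s⟩ with hf
  set e : ℂ := ⟨c, s⟩ with he
  have hef : e * f = 1 := by
    apply Complex.ext <;> simp [he, hf] <;> nlinarith
  have hepf : e + f = (2 * c : ℝ) := by
    apply Complex.ext <;> simp [he, hf]; ring
  have hfn : ‖f‖ = 1 := by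
    rw [← sq_eq_sq₀ (norm_nonneg _) zero_le_one, ← Complex.normSq_eq_norm_sq, Complex.normSq_apply]
    simp [hf]; nlinarith
  have hemf : e - f = 2 * s * I := by
    apply Complex.ext <;> simp [he, hf]; ring
  set η := t - f with hη
  set E := (1 + t ^ 2 + a * t ^ 3 - z * t) + (z - (2 * c : ℝ)) * t with hEdef
  have hEn : ‖E‖ ≤ (K + 2) / N := by
    refine (norm_add_le _ _).trans ?_
    rw [norm_mul]
    have : ‖z - (2 * c : ℝ)‖ * ‖t‖ ≤ 1 / N * 2 := by gcongr
    calc _ ≤ K / N + 1 / N * 2 := add_le_add hE this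
      _ = _ := by ring
  have hprod : (t - e) * η = E - a * t ^ 3 := by
    rw [hEdef, ← hepf, hη]
    linear_combination hef
  have hte : s ≤ ‖t - e‖ := by
    have := Complex.abs_im_le_norm (t - e)
    have h2 : (t - e).im = t.im - s := by simp [he]
    rw [h2] at this
    have := neg_le_abs (t.im - s)
    linarith
  have han : ‖(a : ℂ)‖ ≤ A / q := by simpa using ha
  have hηn : ‖η‖ ≤ (K + 2 + 8 * A) / (q * s) := by
    have h4 : ‖t - e‖ * ‖η‖ ≤ (K + 2 + 8 * A) / q := by
      rw [← norm_mul, hprod]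
      refine (norm_sub_le _ _).trans ?_
      rw [norm_mul, norm_pow]
      have h5 : ‖(a : ℂ)‖ * ‖t‖ ^ 3 ≤ A / q * 2 ^ 3 := by gcongr
      have h6 : (K + 2) / N ≤ (K + 2) / q := by
        gcongr
        nlinarith
      calc _ ≤ (K + 2) / q + A / q * 2 ^ 3 := add_le_add (hEn.trans h6) h5
        _ = _ := by ring
    have h7 : s * ‖η‖ ≤ (K + 2 + 8 * A) / q :=
      (mul_le_mul_of_nonneg_right hte (norm_nonneg _)).trans h4
    rw [le_div_iff₀ (by positivity)]
    rw [le_div_iff₀ hq] at h7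
    linarith
  set C3 := K + 2 + 8 * A
  have hC3 : 0 ≤ C3 := by positivity
  have hmain : -(2 * s * I) * η + a * f ^ 3
      = E - a * (η * (t ^ 2 + t * f + f ^ 2)) - η ^ 2 := by
    have h8 : t - e = η - 2 * s * I := by rw [hη, ← hemf]; ring
    rw [h8] at hprod
    rw [hη] at hprod ⊢
    linear_combination hprod
  have hsum : ‖t ^ 2 + t * f + f ^ 2‖ ≤ 7 := by
    refine (norm_add₃_le).trans ?_
    rw [norm_pow, norm_mul, norm_pow, hfn]
    nlinarith [norm_nonneg t]
  have hmn : ‖-(2 * s * I) * η + a * f ^ 3‖ ≤ (K + 2 + 7 * A * C3 + C3 ^ 2) / (N * s ^ 2) := by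
    rw [hmain]
    refine (norm_sub_le _ _).trans ((add_le_add_left (norm_sub_le _ _) _).trans ?_)
    rw [norm_mul, norm_mul, norm_pow]
    have g1 : (K + 2) / N ≤ (K + 2) / (N * s ^ 2) := by
      gcongr
      have : s ^ 2 ≤ 1 := pow_le_one₀ hθ.le hs1
      nlinarith
    have g2 : ‖(a : ℂ)‖ * (‖η‖ * ‖t ^ 2 + t * f + f ^ 2‖) ≤ A / q * (C3 / (q * s) * 7) := by gcongr
    have g3 : ‖η‖ ^ 2 ≤ (C3 / (q * s)) ^ 2 := by gcongr
    have g4 : A / q * (C3 / (q * s) * 7) ≤ 7 * A * C3 / (N * s ^ 2) := by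
      have : A / q * (C3 / (q * s) * 7) = 7 * A * C3 / (q ^ 2 * s) := by
        field_simp
      rw [this, hqq]
      gcongr
      nlinarith
    have g5 : (C3 / (q * s)) ^ 2 = C3 ^ 2 / (N * s ^ 2) := by
      rw [div_pow, mul_pow, hqq]
    calc _ ≤ (K + 2) / (N * s ^ 2) + 7 * A * C3 / (N * s ^ 2) + C3 ^ 2 / (N * s ^ 2) :=
          add_le_add (add_le_add (hEn.trans g1) (g2.trans g4)) (g3.trans g5.le)
      _ = _ := by ring
  have hre := (Complex.abs_re_le_norm _).trans hmn
  have hreq : (-(2 * s * I) * η + a * f ^ 3).re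
      = 2 * s * (t.im + s) + a * (c ^ 3 - 3 * c * s ^ 2) := by
    simp only [hη, hf, pow_succ, pow_zero, one_mul, Complex.add_re, Complex.mul_re,
      Complex.mul_im, Complex.neg_re, Complex.neg_im, Complex.ofReal_re, Complex.ofReal_im,
      Complex.I_re, Complex.I_im, Complex.sub_re, Complex.sub_im, Complex.re_ofNat,
      Complex.im_ofNat]
    ring
  rw [hreq] at hre
  have hgt : |g.im - t.im| ≤ K / N := by
    have := Complex.abs_im_le_norm (g - t)
    rw [Complex.sub_im] at this
    exact this.trans hg
  have hd : 2 * s * (g.im + s) + a * (c ^ 3 - 3 * c * s ^ 2)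
      = (2 * s * (t.im + s) + a * (c ^ 3 - 3 * c * s ^ 2)) + 2 * s * (g.im - t.im) := by ring
  rw [hd]
  refine (abs_add_le _ _).trans ?_
  have h9 : |2 * s * (g.im - t.im)| ≤ 2 * K / (N * s ^ 2) := by
    rw [abs_mul, abs_of_pos (by positivity : 0 < 2 * s)]
    calc 2 * s * |g.im - t.im| ≤ 2 * 1 * (K / N) := by gcongr
      _ = 2 * K / N := by ring
      _ ≤ _ := by
        gcongr
        have : s ^ 2 ≤ 1 := pow_le_one₀ hθ.le hs1
        nlinarith
  calc _ ≤ _ := add_le_add hre h9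
    _ = _ := by ring

lemma dens_int {ν : Measure ℝ} [IsProbabilityMeasure ν] {p : ℝ → ℝ} (h : HasDensity ν p) :
    Integrable p ∧ ∫ x, p x = 1 := by
  obtain ⟨hc, h0, hd⟩ := h
  have hl : ∫⁻ x, ENNReal.ofReal (p x) = 1 := by
    have : ν univ = 1 := measure_univ
    rw [hd, withDensity_apply _ MeasurableSet.univ] at this
    simpa using this
  have hi : Integrable p := by
    refine ⟨hc.aestronglyMeasurable, ?_⟩
    rw [hasFiniteIntegral_iff_ofReal (ae_of_all _ h0), hl]
    exact ENNReal.one_lt_top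
  refine ⟨hi, ?_⟩
  rw [integral_eq_lintegral_of_nonneg_ae (ae_of_all _ h0) hc.aestronglyMeasurable, hl]
  simp

lemma inversion {ν : Measure ℝ} [IsProbabilityMeasure ν] {p : ℝ → ℝ} (h : HasDensity ν p) (x : ℝ) :
    Tendsto (fun k : ℝ => -(cauchy ν (⟨x, k⁻¹⟩ : ℂ)).im / Real.pi) atTop (𝓝 (p x)) := by
  obtain ⟨hi, -⟩ := dens_int h
  obtain ⟨hc, h0, hd⟩ := h
  have hφ : ∀ y : ℝ, 0 ≤ Real.pi⁻¹ * (1 + y ^ 2)⁻¹ := fun y => by positivity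
  have hφ1 : ∫ y : ℝ, Real.pi⁻¹ * (1 + y ^ 2)⁻¹ = 1 := by
    rw [integral_const_mul, integral_univ_inv_one_add_sq]
    exact inv_mul_cancel₀ Real.pi_ne_zero
  have hdec : Tendsto (fun y : ℝ => ‖y‖ ^ Module.finrank ℝ ℝ * (Real.pi⁻¹ * (1 + y ^ 2)⁻¹))
      (Bornology.cobounded ℝ) (𝓝 0) := by
    have h1 : Tendsto (fun y : ℝ => ‖y‖⁻¹) (Bornology.cobounded ℝ) (𝓝 0) :=
      tendsto_inv_atTop_zero.comp tendsto_norm_cobounded_atTop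
    have h2 := h1.const_mul Real.pi⁻¹
    rw [mul_zero] at h2
    refine squeeze_zero (fun y => by positivity) (fun y => ?_) h2
    rw [Module.finrank_self, pow_one]
    have : ‖y‖ * (1 + y ^ 2)⁻¹ ≤ ‖y‖⁻¹ := by
      rcases eq_or_ne y 0 with rfl | hy
      · simp
      · have hy' : 0 < ‖y‖ := norm_pos_iff.mpr hy
        rw [← div_eq_mul_inv, div_le_iff₀ (by positivity), ← div_eq_inv_mul, le_div_iff₀ hy']
        have : y ^ 2 = ‖y‖ ^ 2 := by simp
        nlinarith
    calc _ = Real.pi⁻¹ * (‖y‖ * (1 + y ^ 2)⁻¹) := by ring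
      _ ≤ _ := by gcongr
  have key := tendsto_integral_comp_smul_smul_of_integrable' (μ := volume) hφ hφ1 hdec
    (g := p) (x₀ := x) hi hc.continuousAt
  refine key.congr' ?_
  filter_upwards [eventually_gt_atTop (0 : ℝ)] with k hk
  have hkim : 0 < (⟨x, k⁻¹⟩ : ℂ).im := inv_pos.mpr hk
  rw [cauchy_im' hkim, neg_div]
  conv_rhs => rw [hd]
  rw [integral_withDensity_eq_integral_toReal_smul (by fun_prop) (by simp)]
  rw [← neg_div, ← integral_neg, ← integral_div]
  refine integral_congr_ae (ae_of_all _ fun u => ?_)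
  simp only [Module.finrank_self, pow_one, smul_eq_mul, ENNReal.toReal_ofReal (h0 u),
    Complex.inv_im, Complex.normSq_apply, Complex.sub_re, Complex.sub_im, Complex.ofReal_re,
    Complex.ofReal_im]
  have : (x - u) * (x - u) + (k⁻¹ - 0) * (k⁻¹ - 0) ≠ 0 := by
    have : 0 < k⁻¹ := inv_pos.mpr hk
    nlinarith [mul_self_nonneg (x - u), mul_pos this this]
  have h4 : 1 + (k * (x - u)) ^ 2 ≠ 0 := by positivity
  have h5 : (x - u) * (x - u) + (k⁻¹ - 0) * (k⁻¹ - 0) = (1 + (k * (x - u)) ^ 2) / k ^ 2 := by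
    field_simp
    ring
  rw [h5]
  field_simp
  ring

lemma cauchy_rescale (ν : Measure ℝ) (n : ℕ) (hn : 1 ≤ n) (z : ℂ) (hz : 0 < z.im) :
    cauchy (rescale n ν) z = (Real.sqrt n : ℂ) * cauchy ν ((Real.sqrt n : ℂ) * z) := by
  have hq : 0 < Real.sqrt n := Real.sqrt_pos.mpr (by exact_mod_cast hn)
  have hqc : (Real.sqrt n : ℂ) ≠ 0 := by exact_mod_cast hq.ne'
  unfold cauchy rescale
  rw [integral_map (by fun_prop) (cont_g hz).aestronglyMeasurable, ← integral_const_mul]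
  refine integral_congr_ae (ae_of_all _ fun u => ?_)
  simp only [Complex.ofReal_div]
  have : (Real.sqrt n : ℂ) * z - u = Real.sqrt n * (z - u / Real.sqrt n) := by field_simp
  rw [this, mul_inv, ← mul_assoc, mul_inv_cancel₀ hqc, one_mul]

lemma subst_cos {f : ℝ → ℝ} (hf : Continuous f) (t : ℝ) :
    ∫ x in (-(2 * Real.cos t))..(2 * Real.cos t), f x
      = ∫ θ in t..(Real.pi - t), f (2 * Real.cos θ) * (2 * Real.sin θ) := by
  have h := intervalIntegral.integral_comp_mul_deriv (a := Real.pi - t) (b := t)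
    (f := fun θ => 2 * Real.cos θ) (f' := fun θ => 2 * (-Real.sin θ)) (g := f)
    (fun x _ => (Real.hasDerivAt_cos x).const_mul 2) (by fun_prop) hf
  simp only [Real.cos_pi_sub, Function.comp] at h
  rw [mul_neg] at h
  rw [← h, intervalIntegral.integral_symm, ← intervalIntegral.integral_neg]
  congr 1
  ext θ
  ring

lemma abs_cos3 : ∫ θ in (0 : ℝ)..Real.pi, |Real.cos (3 * θ)| = 2 := by
  have h1 := intervalIntegral.integral_comp_mul_left (a := 0) (b := Real.pi)
    (fun u => |Real.cos u|) (three_ne_zero : (3 : ℝ) ≠ 0)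
  rw [h1]
  have hper : Function.Periodic (fun u => |Real.cos u|) Real.pi := fun u => by
    simp [Real.cos_add_pi]
  have h2 := hper.intervalIntegral_add_zsmul_eq 3 0 
    (fun t₁ t₂ => Continuous.intervalIntegrable (by fun_prop) _ _)
  have h3 := hper.intervalIntegral_add_eq 0 (-(Real.pi / 2))
  have h4 : ∫ u in (-(Real.pi / 2))..(-(Real.pi / 2) + Real.pi), |Real.cos u| = 2 := by
    have e : -(Real.pi / 2) + Real.pi = Real.pi / 2 := by ring
    rw [e]
    have : ∫ u in (-(Real.pi / 2))..(Real.pi / 2), |Real.cos u|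
        = ∫ u in (-(Real.pi / 2))..(Real.pi / 2), Real.cos u := by
      apply intervalIntegral.integral_congr
      intro u hu
      rw [uIcc_of_le (by linarith [Real.pi_pos])] at hu
      exact abs_of_nonneg (Real.cos_nonneg_of_mem_Icc hu)
    rw [this, integral_cos]
    simp
    norm_num
  rw [h4] at h3
  simp only [zero_add] at h2 h3
  rw [h3] at h2
  have e3 : (3 : ℤ) • Real.pi = 3 * Real.pi := by simp
  rw [e3] at h2
  rw [mul_zero, h2]
  simp

lemma abs_cos3_trunc {t : ℝ} (ht : 0 ≤ t) :
    |(∫ θ in t..(Real.pi - t), |Real.cos (3 * θ)|) - 2| ≤ 2 * t := by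
  have hi : ∀ a b, IntervalIntegrable (fun θ => |Real.cos (3 * θ)|) volume a b :=
    fun a b => Continuous.intervalIntegrable (by fun_prop) _ _
  have h1 := intervalIntegral.integral_add_adjacent_intervals (hi 0 t) (hi t (Real.pi - t))
  have h2 := intervalIntegral.integral_add_adjacent_intervals (hi 0 (Real.pi - t))
    (hi (Real.pi - t) Real.pi)
  rw [abs_cos3] at h2
  have b : ∀ a b : ℝ, |(∫ θ in a..b, |Real.cos (3 * θ)|)| ≤ 1 * |b - a| := fun a b => by
    have := intervalIntegral.norm_integral_le_of_norm_le_const (E := ℝ) (a := a) (b := b) (C := 1)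
      (f := fun θ => |Real.cos (3 * θ)|) (fun x _ => by simpa using Real.abs_cos_le_one (3 * x))
    exact this
  have b1 := b 0 t
  have b2 := b (Real.pi - t) Real.pi
  have e1 : |t - 0| = t := by simpa using ht
  have e2 : |Real.pi - (Real.pi - t)| = t := by simpa using ht
  rw [e1] at b1
  rw [e2] at b2
  rw [abs_le] at *
  constructor <;> linarith

lemma sin_pos_Icc {t θ : ℝ} (ht : 0 < t) (h : θ ∈ Icc t (Real.pi - t)) : 0 < Real.sin θ :=
  Real.sin_pos_of_pos_of_lt_pi (by linarith [h.1]) (by linarith [h.2])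

lemma inv_sin_sq {t : ℝ} (ht : 0 < t) (ht1 : t ≤ 1 / 2) :
    IntervalIntegrable (fun θ => 1 / Real.sin θ ^ 2) volume t (Real.pi - t) ∧
    ∫ θ in t..(Real.pi - t), 1 / Real.sin θ ^ 2 ≤ Real.pi / t := by
  have hpi := Real.pi_gt_three
  have hle : t ≤ Real.pi - t := by linarith
  have hii : IntervalIntegrable (fun θ => 1 / Real.sin θ ^ 2) volume t (Real.pi - t) := by
    apply ContinuousOn.intervalIntegrable
    rw [uIcc_of_le hle]
    refine ContinuousOn.div (by fun_prop) (by fun_prop) fun θ hθ => ?_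
    have := sin_pos_Icc ht hθ
    positivity
  refine ⟨hii, ?_⟩
  have hd : ∀ θ ∈ uIcc t (Real.pi - t),
      HasDerivAt (fun θ => - (Real.cos θ / Real.sin θ)) (1 / Real.sin θ ^ 2) θ := by
    intro θ hθ
    rw [uIcc_of_le hle] at hθ
    have := sin_pos_Icc ht hθ
    refine ((Real.hasDerivAt_cos θ).div (Real.hasDerivAt_sin θ) this.ne').neg.congr_deriv ?_
    have h := Real.sin_sq_add_cos_sq θ
    rw [← neg_div]
    congr 1
    linarith
  rw [intervalIntegral.integral_eq_sub_of_hasDerivAt hd hii, Real.cos_pi_sub, Real.sin_pi_sub]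
  have hs : 2 / Real.pi * t ≤ Real.sin t := Real.mul_le_sin ht.le (by linarith)
  have hs0 : 0 < 2 / Real.pi * t := by positivity
  calc -(-Real.cos t / Real.sin t) - -(Real.cos t / Real.sin t)
      = 2 * Real.cos t / Real.sin t := by ring
    _ ≤ 2 * 1 / (2 / Real.pi * t) := by
        gcongr
        exact Real.cos_le_one t
    _ = Real.pi / t := by field_simp

lemma pw_cont : Continuous pw := by unfold pw; fun_prop

lemma pw_nonneg (x : ℝ) : 0 ≤ pw x := by unfold pw; positivity

lemma pw_cos {θ : ℝ} (h : 0 ≤ Real.sin θ) : pw (2 * Real.cos θ) = Real.sin θ / Real.pi := by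
  unfold pw
  have : 4 - (2 * Real.cos θ) ^ 2 = (2 * Real.sin θ) ^ 2 := by
    nlinarith [Real.sin_sq_add_cos_sq θ]
  rw [this, max_eq_left (by positivity), Real.sqrt_sq (by positivity)]
  field_simp

lemma pw_zero {x : ℝ} (h : x ∉ Ioc (-2 : ℝ) 2) : pw x = 0 := by
  unfold pw
  have : 4 - x ^ 2 ≤ 0 := by
    rw [mem_Ioc, not_and_or] at h
    push Not at h
    rcases h with h | h <;> nlinarith
  rw [max_eq_right this]
  simp

lemma pw_int : Integrable pw := by
  have h : IntegrableOn pw (Ioc (-2 : ℝ) 2) :=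
    (pw_cont.integrableOn_Icc (a := -2) (b := 2)).mono_set Ioc_subset_Icc_self
  exact h.integrable_of_forall_notMem_eq_zero fun x hx => pw_zero hx

lemma pw_theta {t : ℝ} (ht : 0 ≤ t) (ht1 : t ≤ 1 / 2) :
    ∫ x in (-(2 * Real.cos t))..(2 * Real.cos t), pw x
      = 2 / Real.pi * ∫ θ in t..(Real.pi - t), Real.sin θ ^ 2 := by
  rw [subst_cos pw_cont, ← intervalIntegral.integral_const_mul]
  apply intervalIntegral.integral_congr
  intro θ hθ
  rw [uIcc_of_le (by linarith [Real.pi_gt_three])] at hθ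
  have := Real.sin_nonneg_of_nonneg_of_le_pi (x := θ) (by linarith [hθ.1]) (by linarith [hθ.2])
  simp only
  rw [pw_cos this]
  ring

lemma pw_one : ∫ x, pw x = 1 := by
  have h := pw_theta (t := 0) le_rfl (by norm_num)
  rw [Real.cos_zero, intervalIntegral.integral_of_le (by norm_num), mul_one,
    setIntegral_eq_integral_of_forall_compl_eq_zero (fun x hx => pw_zero hx)] at h
  rw [h, integral_sin_sq]
  simp

lemma pw_bulk {t : ℝ} (ht : 0 < t) (ht1 : t ≤ 1 / 2) :
    1 - ∫ x in (-(2 * Real.cos t))..(2 * Real.cos t), pw x ≤ t ^ 3 := by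
  rw [pw_theta ht.le ht1, integral_sin_sq, Real.sin_pi_sub, Real.cos_pi_sub]
  have h := Real.sin_gt_sub_cube (x := 2 * t) (by linarith)
  rw [Real.sin_two_mul] at h
  have hpi := Real.pi_gt_three
  have : 1 - 2 / Real.pi * ((Real.sin t * Real.cos t - Real.sin t * -Real.cos t
      + (Real.pi - t) - t) / 2) = (2 * t - 2 * Real.sin t * Real.cos t) / Real.pi := by
    field_simp
    ring
  rw [this, div_le_iff₀ Real.pi_pos]
  have : 0 < t ^ 3 := by positivity
  nlinarith

lemma final_int {p : ℝ → ℝ} (hc : Continuous p) (h0 : ∀ x, 0 ≤ p x) (hi : Integrable p)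
    (h1 : ∫ x, p x = 1) {a K : ℝ} (hK : 0 ≤ K)
    (H : ∀ θ, 0 < Real.sin θ → |2 * Real.sin θ * (Real.pi * p (2 * Real.cos θ) - Real.sin θ)
      - a * Real.cos (3 * θ)| ≤ K / Real.sin θ ^ 2)
    {t : ℝ} (ht : 0 < t) (ht1 : t ≤ 1 / 2) :
    |(∫ x, |p x - pw x|) - 2 * |a| / Real.pi| ≤ 2 * K / t + |a| * t + 2 * t ^ 3 := by
  have hpi := Real.pi_gt_three
  have hle : t ≤ Real.pi - t := by linarith
  have hcos : 0 ≤ Real.cos t := Real.cos_nonneg_of_mem_Icc ⟨by linarith, by linarith⟩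
  obtain ⟨hsi, hsb⟩ := inv_sin_sq ht ht1
  set b := 2 * Real.cos t with hb
  have hb0 : -b ≤ b := by linarith
  set D : ℝ → ℝ := fun θ => (p (2 * Real.cos θ) - pw (2 * Real.cos θ)) * (2 * Real.sin θ) with hD
  have hDc : Continuous D := by
    have := pw_cont
    fun_prop
  have hDb : ∀ θ ∈ Icc t (Real.pi - t), |D θ - a / Real.pi * Real.cos (3 * θ)|
      ≤ K / Real.pi * (1 / Real.sin θ ^ 2) := by
    intro θ hθ
    have hs := sin_pos_Icc ht hθ
    have h := H θ hs
    have e : D θ - a / Real.pi * Real.cos (3 * θ) = (2 * Real.sin θ *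
        (Real.pi * p (2 * Real.cos θ) - Real.sin θ) - a * Real.cos (3 * θ)) / Real.pi := by
      simp only [hD]
      rw [pw_cos hs.le]
      field_simp
    rw [e, abs_div, abs_of_pos Real.pi_pos, div_le_iff₀ Real.pi_pos]
    calc _ ≤ _ := h
      _ = _ := by field_simp
  have hKint : ∫ θ in t..(Real.pi - t), K / Real.pi * (1 / Real.sin θ ^ 2) ≤ K / t := by
    rw [intervalIntegral.integral_const_mul]
    calc _ ≤ K / Real.pi * (Real.pi / t) := by gcongr
      _ = K / t := by field_simp
  -- generic comparison
  have cmp : ∀ f g : ℝ → ℝ, Continuous f → Continuous g →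
      (∀ θ ∈ Icc t (Real.pi - t), |f θ - g θ| ≤ K / Real.pi * (1 / Real.sin θ ^ 2)) →
      |(∫ θ in t..(Real.pi - t), f θ) - ∫ θ in t..(Real.pi - t), g θ| ≤ K / t := by
    intro f g hf hg hfg
    rw [← intervalIntegral.integral_sub (hf.intervalIntegrable _ _) (hg.intervalIntegrable _ _)]
    refine le_trans ?_ hKint
    refine intervalIntegral.norm_integral_le_of_norm_le (E := ℝ) hle ?_ (hsi.const_mul _)
    exact ae_of_all _ fun θ hθ => hfg θ (Ioc_subset_Icc_self hθ)
  have hS := cmp D (fun θ => a / Real.pi * Real.cos (3 * θ)) hDc (by fun_prop) hDb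
  have hA := cmp (fun θ => |D θ|) (fun θ => |a| / Real.pi * |Real.cos (3 * θ)|) hDc.abs
    (by fun_prop) (fun θ hθ => by
      have e : |a| / Real.pi * |Real.cos (3 * θ)| = |a / Real.pi * Real.cos (3 * θ)| := by
        rw [abs_mul, abs_div, abs_of_pos Real.pi_pos]
      rw [e]
      exact (abs_abs_sub_abs_le _ _).trans (hDb θ hθ))
  have hcos0 : ∫ θ in t..(Real.pi - t), a / Real.pi * Real.cos (3 * θ) = 0 := by
    rw [intervalIntegral.integral_const_mul, intervalIntegral.integral_comp_mul_left _ three_ne_zero,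
      integral_cos]
    have : Real.sin (3 * (Real.pi - t)) = Real.sin (3 * t) := by
      have : 3 * (Real.pi - t) = (Real.pi - 3 * t) + 2 * Real.pi := by ring
      rw [this, Real.sin_add_two_pi, Real.sin_pi_sub]
    rw [this]
    simp
  rw [hcos0, sub_zero] at hS
  rw [intervalIntegral.integral_const_mul] at hA
  have hc3 := abs_cos3_trunc ht.le
  have hSx : ∫ θ in t..(Real.pi - t), D θ = ∫ x in (-b)..b, (p x - pw x) := by
    rw [hb]
    exact (subst_cos (f := fun x => p x - pw x) (hc.sub pw_cont) t).symm
  have hAx : ∫ θ in t..(Real.pi - t), |D θ| = ∫ x in (-b)..b, |p x - pw x| := by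
    rw [hb, subst_cos (f := fun x => |p x - pw x|) (hc.sub pw_cont).abs]
    apply intervalIntegral.integral_congr
    intro θ hθ
    rw [uIcc_of_le hle] at hθ
    have hs := sin_pos_Icc ht hθ
    simp only [hD]
    rw [abs_mul, abs_of_pos (by positivity : 0 < 2 * Real.sin θ)]
  rw [hSx, intervalIntegral.integral_sub (hc.intervalIntegrable _ _)
    (pw_cont.intervalIntegrable _ _)] at hS
  rw [hAx] at hA
  have hPB := pw_bulk ht ht1
  have hdi : Integrable fun x => |p x - pw x| := (hi.sub pw_int).abs
  set B := Ioc (-b) b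
  have hBm : MeasurableSet B := measurableSet_Ioc
  rw [intervalIntegral.integral_of_le hb0] at hA hPB hS
  rw [intervalIntegral.integral_of_le hb0] at hS
  have s1 := integral_add_compl hBm hdi
  have s2 := integral_add_compl hBm hi
  have s3 := integral_add_compl hBm pw_int
  rw [h1] at s2
  rw [pw_one] at s3
  have out : ∫ x in Bᶜ, |p x - pw x| ≤ (∫ x in Bᶜ, p x) + ∫ x in Bᶜ, pw x := by
    rw [← integral_add hi.integrableOn pw_int.integrableOn]
    refine integral_mono hdi.integrableOn (hi.add pw_int).integrableOn fun x => ?_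
    have := h0 x
    have := pw_nonneg x
    simp only
    rw [abs_le]; constructor <;> linarith
  have out0 : 0 ≤ ∫ x in Bᶜ, |p x - pw x| := integral_nonneg fun x => abs_nonneg _
  set c3 := ∫ θ in t..(Real.pi - t), |Real.cos (3 * θ)|
  have hac : |(|a| / Real.pi * c3 - 2 * |a| / Real.pi)| ≤ |a| * t := by
    have e : |a| / Real.pi * c3 - 2 * |a| / Real.pi = |a| / Real.pi * (c3 - 2) := by ring
    rw [e, abs_mul, abs_of_nonneg (by positivity : 0 ≤ |a| / Real.pi)]
    calc |a| / Real.pi * |c3 - 2| ≤ |a| / 2 * (2 * t) := by gcongr; linarith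
      _ = |a| * t := by ring
  have hKt : 2 * K / t = K / t + K / t := by ring
  rw [hKt]
  rw [abs_le] at hac hA hS ⊢
  have : 0 ≤ t ^ 3 := by positivity
  constructor <;> linarith [hac.1, hac.2, hA.1, hA.2, hS.1, hS.2]

def KK (A M : ℝ) : ℝ :=
  3 * (8 + 16 * A + 16 * M * (20 + 32 * A)) + 8 * M * (20 + 32 * A)

def CC (A M : ℝ) : ℝ :=
  3 * KK A M + 2 + 7 * A * (KK A M + 2 + 8 * A) + (KK A M + 2 + 8 * A) ^ 2

lemma core {μ : Measure ℝ} [IsProbabilityMeasure μ] (h8 : Integrable (fun u : ℝ => u ^ 8) μ)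
    (h1 : mom μ 1 = 0) (h2 : mom μ 2 = 1) {n : ℕ} (hn : 2 ≤ n)
    (hn4 : 2 + 4 * mom μ 4 ≤ n) (hn8 : 32 * (mom μ 8 + 1) ≤ n)
    {Z : ℂ → ℂ} {ν : Measure ℝ} (hbox : IsBoxPow μ n Z ν) {θ : ℝ} (hθ : 0 < Real.sin θ)
    {z : ℂ} (hz : 0 < z.im) (hz3 : ‖z‖ ≤ 3) (hzx : ‖z - (2 * Real.cos θ : ℝ)‖ ≤ 1 / n) :
    |2 * Real.sin θ * ((cauchy (rescale n ν) z).im + Real.sin θ) + aQ μ n * Real.cos (3 * θ)|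
      ≤ CC |mom μ 3| (mom μ 8 + 1) / (n * Real.sin θ ^ 2) := by
  obtain ⟨⟨⟨τ, hτ, hZτ⟩, hsub⟩, hνp, hνZ⟩ := hbox
  have hnR : (2 : ℝ) ≤ n := by exact_mod_cast hn
  have hn0 : (0 : ℝ) < n := by linarith
  have hq : 0 < Real.sqrt n := Real.sqrt_pos.mpr hn0
  have hqq : Real.sqrt n ^ 2 = n := Real.sq_sqrt hn0.le
  have hq1 : 1 ≤ Real.sqrt n := Real.one_le_sqrt.mpr (by linarith)
  have hζ : 0 < ((Real.sqrt n : ℂ) * z).im := by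
    rw [Complex.im_ofReal_mul]; positivity
  rw [cauchy_rescale ν n (by omega) z hz]
  have hs := hsub _ hζ
  have hw : 0 < (Z ((Real.sqrt n : ℂ) * z)).im := by
    rw [hZτ _ hζ]; exact recip_im_pos hζ
  have hcν : cauchy ν ((Real.sqrt n : ℂ) * z) = cauchy μ (Z ((Real.sqrt n : ℂ) * z)) :=
    inv_injective (hνZ _ hζ)
  rw [hcν]
  set w := Z ((Real.sqrt n : ℂ) * z) with hwdef
  have hs' : (Real.sqrt n : ℂ) * z = ((n : ℝ) : ℂ) * w - (((n : ℝ) : ℂ) - 1) * recip μ w := by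
    simpa using hs
  have hzz : 0 < (((n : ℝ) : ℂ) * w - (((n : ℝ) : ℂ) - 1) * recip μ w).im := by
    rw [← hs']; exact hζ
  have hlow := lower h8 h1 h2 hw (by linarith : (1 : ℝ) < n) hzz
  obtain ⟨ρ, hρ, hexp⟩ := expand h8 h1 h2 hw hnR hzz
  have hGne := cauchy_ne (μ := μ) hw
  have hw0 : w ≠ 0 := by intro h; rw [h] at hw; simp at hw
  rw [recip] at hs'
  set G := cauchy μ w
  have hM : 0 ≤ mom μ 8 + 1 := (norm_nonneg _).trans hρ
  have haq : |aQ μ n| = |mom μ 3| / Real.sqrt n := by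
    rw [aQ, abs_div, abs_of_pos hq]
  have haA : |aQ μ n| ≤ |mom μ 3| := by
    rw [haq]; exact div_le_self (abs_nonneg _) hq1
  have haC : (mom μ 3 : ℂ) = (aQ μ n : ℂ) * (Real.sqrt n : ℂ) := by
    rw [aQ]; push_cast
    have : (Real.sqrt n : ℂ) ≠ 0 := by exact_mod_cast hq.ne'
    field_simp
  set a := aQ μ n
  rw [haC] at hexp
  have hNq : ((n : ℝ) : ℂ) = (Real.sqrt n : ℂ) ^ 2 := by exact_mod_cast hqq.symm
  have hqc : (Real.sqrt n : ℂ) ≠ 0 := by exact_mod_cast hq.ne'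
  have hqn : ‖(Real.sqrt n : ℂ)‖ = Real.sqrt n := by simp
  set q := Real.sqrt n
  set t : ℂ := q / w with ht
  have htw : w⁻¹ = t / q := by rw [ht]; field_simp
  have ht0 : t ≠ 0 := div_ne_zero hqc hw0
  have htn : ‖t‖ ≤ 2 := by
    rw [ht, norm_div, hqn, div_le_iff₀ (norm_pos_iff.mpr hw0)]
    rw [← sq_le_sq₀ hq.le (by positivity), hqq, mul_pow]
    linarith
  have htim : t.im < 0 := by
    have : t = q * w⁻¹ := by rw [ht]; ring
    rw [this, Complex.im_ofReal_mul, Complex.inv_im, neg_div, mul_neg, neg_lt_zero]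
    have := Complex.normSq_pos.mpr hw0
    positivity
  have e1 : (q * G) * (1 - ρ * t ^ 4 / ((n : ℝ) : ℂ) ^ 2)
      = t + t ^ 3 / ((n : ℝ) : ℂ) + a * t ^ 4 / ((n : ℝ) : ℂ) := by
    rw [htw] at hexp
    rw [hNq]
    have : (q : ℂ) * (G * (1 - ρ * (t / q) ^ 4)) = q * (t / q + (t / q) ^ 3
      + (a * q) * (t / q) ^ 4) := by rw [hexp]
    calc _ = (q : ℂ) * (G * (1 - ρ * (t / q) ^ 4)) := by field_simp
      _ = _ := this
      _ = _ := by field_simp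
  have e2 : (q * G) * z * t = ((n : ℝ) : ℂ) * (q * G) - (((n : ℝ) : ℂ) - 1) * t := by
    rw [ht]
    have : (q * z) * (G * q / w) = (((n : ℝ) : ℂ) * w - (((n : ℝ) : ℂ) - 1) * G⁻¹) * (G * q / w) := by
      rw [hs']
    calc _ = (q * z) * (G * q / w) := by ring
      _ = _ := this
      _ = _ := by field_simp
  obtain ⟨b1, b2⟩ := alg1 (N := n) (by linarith) hn8 hM haA ht0 htn hρ hz3 e1 e2
  have hA0 : 0 ≤ |mom μ 3| := abs_nonneg _
  have hKK : 0 ≤ KK |mom μ 3| (mom μ 8 + 1) := by unfold KK; positivity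
  have b1' : ‖q * G - t‖ ≤ KK |mom μ 3| (mom μ 8 + 1) / n := by
    refine b1.trans ?_
    unfold KK
    refine div_le_div_of_nonneg_right ?_ hn0.le
    set A := |mom μ 3|
    set M := mom μ 8 + 1
    have : 0 ≤ M * A := by positivity
    nlinarith
  exact alg2 (N := n) (by linarith) hKK haq.le hθ htn htim b1' b2 hzx

lemma CC_nonneg {A M : ℝ} (hA : 0 ≤ A) (hM : 0 ≤ M) : 0 ≤ CC A M := by
  unfold CC KK; positivity

lemma dens_bound {μ : Measure ℝ} [IsProbabilityMeasure μ] (h8 : Integrable (fun u : ℝ => u ^ 8) μ)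
    (h1 : mom μ 1 = 0) (h2 : mom μ 2 = 1) {n : ℕ} (hn : 2 ≤ n)
    (hn4 : 2 + 4 * mom μ 4 ≤ n) (hn8 : 32 * (mom μ 8 + 1) ≤ n)
    {Z : ℂ → ℂ} {ν : Measure ℝ} (hbox : IsBoxPow μ n Z ν) {p : ℝ → ℝ}
    [IsProbabilityMeasure (rescale n ν)]
    (hp : HasDensity (rescale n ν) p) {θ : ℝ} (hθ : 0 < Real.sin θ) :
    |2 * Real.sin θ * (Real.pi * p (2 * Real.cos θ) - Real.sin θ) - aQ μ n * Real.cos (3 * θ)|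
      ≤ CC |mom μ 3| (mom μ 8 + 1) / n / Real.sin θ ^ 2 := by
  have hlim := inversion hp (2 * Real.cos θ)
  have hlim2 : Tendsto (fun k : ℝ => |2 * Real.sin θ * (Real.pi *
      (-(cauchy (rescale n ν) (⟨2 * Real.cos θ, k⁻¹⟩ : ℂ)).im / Real.pi) - Real.sin θ)
      - aQ μ n * Real.cos (3 * θ)|) atTop
      (𝓝 |2 * Real.sin θ * (Real.pi * p (2 * Real.cos θ) - Real.sin θ)
        - aQ μ n * Real.cos (3 * θ)|) :=
    ((((hlim.const_mul _).sub_const _).const_mul _).sub_const _).abs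
  refine le_of_tendsto hlim2 ?_
  have hnR : (2 : ℝ) ≤ n := by exact_mod_cast hn
  filter_upwards [eventually_ge_atTop (n : ℝ)] with k hk
  have hk0 : 0 < k := by linarith
  set z : ℂ := ⟨2 * Real.cos θ, k⁻¹⟩ with hz
  have hd : z - (2 * Real.cos θ : ℝ) = (k⁻¹ : ℝ) * I := by
    exact Complex.ext (by simp only [hz, Complex.sub_re, Complex.ofReal_re, Complex.re_ofReal_mul, Complex.I_re]; ring)
      (by simp only [hz, Complex.sub_im, Complex.ofReal_im, Complex.im_ofReal_mul, Complex.I_im]; ring)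
  have hkn : k⁻¹ ≤ 1 / n := by
    rw [one_div]; exact inv_anti₀ (by linarith) hk
  have hk1 : k⁻¹ ≤ 1 := inv_le_one_of_one_le₀ (by linarith)
  have hki : 0 < k⁻¹ := inv_pos.mpr hk0
  have hdn : ‖z - (2 * Real.cos θ : ℝ)‖ = k⁻¹ := by
    rw [hd, norm_mul, Complex.norm_I, mul_one, Complex.norm_real, Real.norm_of_nonneg hki.le]
  have hz3 : ‖z‖ ≤ 3 := by
    have e : z = (2 * Real.cos θ : ℝ) + (z - (2 * Real.cos θ : ℝ)) := by ring
    rw [e]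
    refine (norm_add_le _ _).trans ?_
    rw [hdn, Complex.norm_real, norm_mul, Real.norm_eq_abs (Real.cos θ)]
    have := Real.abs_cos_le_one θ
    norm_num
    linarith
  have := core h8 h1 h2 hn hn4 hn8 hbox hθ (z := z) hki hz3 (hdn.le.trans hkn)
  rw [div_div]
  refine le_trans (le_of_eq ?_) this
  rw [mul_div_cancel₀ _ Real.pi_ne_zero, ← abs_neg]
  congr 1
  ring

theorem stmt_1
    (μ : Measure ℝ) [IsProbabilityMeasure μ]
    (hnotdirac : ¬ ∃ c : ℝ, μ = Measure.dirac c)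
    (h8 : Integrable (fun u => u ^ 8) μ)
    (h1 : mom μ 1 = 0) (h2 : mom μ 2 = 1)
    (Z : ℕ → ℂ → ℂ) (ν : ℕ → Measure ℝ)
    (hbox : ∀ n : ℕ, 1 ≤ n → IsBoxPow μ n (Z n) (ν n))
    (p : ℕ → ℝ → ℝ)
    (hp : ∀ᶠ n in atTop, HasDensity (rescale n (ν n)) (p n))
    (h3 : mom μ 3 ≠ 0) :
    ∃ c : ℝ, 0 < c ∧ ∃ n₁ : ℕ, ∀ n : ℕ, n₁ ≤ n →
      |(∫ x : ℝ, |p n x - pw x|) - 2 * |mom μ 3| / (Real.pi * Real.sqrt n)|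
        ≤ c * (|aQ μ n| ^ ((3 : ℝ) / 2) + 1 / (n : ℝ)) := by
  have hA : 0 < |mom μ 3| := abs_pos.mpr h3
  have hm8 : 0 ≤ mom μ 8 := integral_nonneg fun u => by positivity
  set A := |mom μ 3| with hAdef
  have hC := CC_nonneg hA.le (by linarith : 0 ≤ mom μ 8 + 1)
  set C := CC A (mom μ 8 + 1) with hCdef
  have hAp : 0 < A ^ ((3 : ℝ) / 2) := Real.rpow_pos_of_pos hA _
  refine ⟨(2 * C + A + 2) / A ^ ((3 : ℝ) / 2), by positivity, ?_⟩
  have hev := ((hp.and (eventually_ge_atTop 16)).and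
    ((tendsto_natCast_atTop_atTop (R := ℝ)).eventually_ge_atTop (2 + 4 * mom μ 4))).and
    ((tendsto_natCast_atTop_atTop (R := ℝ)).eventually_ge_atTop (32 * (mom μ 8 + 1)))
  obtain ⟨n₁, hn₁⟩ := eventually_atTop.mp hev
  refine ⟨n₁, fun n hn => ?_⟩
  obtain ⟨⟨⟨hpn, hn16⟩, hn4⟩, hn8⟩ := hn₁ n hn
  have hb := hbox n (by omega)
  have hνp : IsProbabilityMeasure (ν n) := hb.2.1
  have hrp : IsProbabilityMeasure (rescale n (ν n)) :=
    Measure.isProbabilityMeasure_map (by fun_prop)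
  obtain ⟨hi, hi1⟩ := dens_int hpn
  have hnR : (16 : ℝ) ≤ n := by exact_mod_cast hn16
  have hn0 : (0 : ℝ) < n := by linarith
  obtain ⟨r, hr2, hrn, hrs⟩ : ∃ r : ℝ, 2 ≤ r ∧ (n : ℝ) = r ^ 4 ∧ Real.sqrt n = r ^ 2 := by
    have e : Real.sqrt (Real.sqrt n) ^ 2 = Real.sqrt n := Real.sq_sqrt (Real.sqrt_nonneg _)
    refine ⟨Real.sqrt (Real.sqrt n), ?_, ?_, e.symm⟩
    · apply Real.le_sqrt_of_sq_le
      apply Real.le_sqrt_of_sq_le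
      linarith
    · calc (n : ℝ) = Real.sqrt n ^ 2 := (Real.sq_sqrt hn0.le).symm
        _ = (Real.sqrt (Real.sqrt n) ^ 2) ^ 2 := by rw [e]
        _ = _ := by ring
  have hr0 : 0 < r := by linarith
  have hfin := final_int hpn.1 hpn.2.1 hi hi1 (a := aQ μ n) (K := C / n) (by positivity)
    (fun θ hθ => dens_bound h8 h1 h2 (by omega) hn4 hn8 hb hpn hθ) (t := r⁻¹) (by positivity)
    (by rw [one_div]; exact inv_anti₀ (by norm_num) hr2)
  have haq : |aQ μ n| = A / r ^ 2 := by
    rw [aQ, abs_div, abs_of_nonneg (Real.sqrt_nonneg _), hrs]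
  have e1 : 2 * |aQ μ n| / Real.pi = 2 * A / (Real.pi * Real.sqrt n) := by
    rw [haq, hrs]; field_simp
  rw [e1] at hfin
  refine hfin.trans ?_
  have e2 : |aQ μ n| ^ ((3 : ℝ) / 2) = A ^ ((3 : ℝ) / 2) / r ^ 3 := by
    rw [haq, Real.div_rpow hA.le (by positivity), ← Real.rpow_natCast r 2, ← Real.rpow_mul hr0.le]
    norm_num
  rw [e2, haq, hrn]
  have e3 : 2 * (C / r ^ 4) / r⁻¹ + A / r ^ 2 * r⁻¹ + 2 * r⁻¹ ^ 3 = (2 * C + A + 2) / r ^ 3 := by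
    field_simp
  rw [e3]
  have e4 : (2 * C + A + 2) / A ^ ((3 : ℝ) / 2) * (A ^ ((3 : ℝ) / 2) / r ^ 3 + 1 / r ^ 4)
      = (2 * C + A + 2) / r ^ 3 + (2 * C + A + 2) / A ^ ((3 : ℝ) / 2) * (1 / r ^ 4) := by
    field_simp
  rw [e4]
  have : 0 ≤ (2 * C + A + 2) / A ^ ((3 : ℝ) / 2) * (1 / r ^ 4) := by positivity
  linarith


end FreeCLT
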